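/- arXiv:2205.01599 — 4 statements merged into one kernel-verified Lean document; each statement's English description precedes it below -/
import Mathlib

section
/- Let (X₁,d₁) and (X₂,d₂) be metric spaces, X := X₁ × X₂ with a product metric, (P,ρ) a separable metric space with a countable dense subset Q, Z := X₁ × P with a product metric, and l ≥ 1 an integer. Suppose G : Z → (subsets of X₁^l) satisfies: for every z = (x,p) ∈ Z the set G(z) is nonempty, and for any u ∈ G(z) and any sequence (xₙ) in X₁ converging to x there is a sequence (pₙ) in Q converging to p such that, with zₙ = (xₙ,pₙ), eventually u ∈ G(zₙ) ⊆ G(z). Suppose Φ : Z × X₁^l × X₂ → ℝ ∪ {+∞} is such that for every y ∈ X₂ the function Φ(·,·,y) satisfies: (A2.1) for every z ∈ Z and u ∈ G(z), if zₙ → z then Φ(zₙ,u,y) → Φ(z,u,y); (A2.2) for every z ∈ Z, every nonempty A ⊆ X₁^l intersecting G(z) and every sequence zₙ → z, limsup_n sup{Φ(zₙ,u,y) : u ∈ A ∩ G(z)} ≤ sup{Φ(z,u,y) : u ∈ A ∩ G(z)}; and additionally for every z ∈ Z the function y ↦ Φ(z,u,y) is continuous at every y ∈ X₂ uniformly in u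 ∈ G(z). Then the family 𝓡 of closed separable subsets of X of the form Y = Y₁ × Y₂, with Y₁ a closed separable subset of X₁ and Y₂ a closed separable subset of X₂, such that for every (x,y) ∈ Y₁ × Y₂ and every p ∈ P, writing z = (x,p), one has Y₁^l ∩ G(z) ≠ ∅ and sup{Φ(z,u,y) : u ∈ G(z)} = sup{Φ(z,u,y) : u ∈ Y₁^l ∩ G(z)}, is a rich family of closed separable subsets of X. -/
open Filter TopologicalSpace Set Metric
open scoped Topology

/-- A family `R` of closed separable subsets of a metric space `X` is *rich* if
(i) every separable subset of `X` is contained in some member of `R` (cofinality), and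
(ii) for every increasing sequence of members of `R`, the closure of its union belongs
to `R` (σ-closedness). -/
def IsRichFamily {X : Type*} [MetricSpace X] (R : Set (Set X)) : Prop :=
  (∀ Y ∈ R, IsClosed Y ∧ TopologicalSpace.IsSeparable Y) ∧
  (∀ Y₀ : Set X, TopologicalSpace.IsSeparable Y₀ → ∃ Y ∈ R, Y₀ ⊆ Y) ∧
  (∀ Y : ℕ → Set X, (∀ n, Y n ∈ R) → (∀ n, Y n ⊆ Y (n + 1)) →
    closure (⋃ n, Y n) ∈ R)

lemma EReal.le_of_forall_pos_le_add_coe {a b : EReal}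
    (h : ∀ ε : ℝ, 0 < ε → a ≤ b + ε) : a ≤ b := by
  induction b with
  | bot => simpa using h 1 one_pos
  | top => exact le_top
  | coe r =>
    refine EReal.le_of_forall_lt_iff_le.1 fun z hz => ?_
    have hrz : r < z := EReal.coe_lt_coe_iff.1 hz
    have := h (z - r) (_root_.sub_pos.2 hrz)
    rwa [← EReal.coe_add, add_sub_cancel] at this

/-- Every nonempty set contains a countable nonempty subset on which a given function has the
same supremum. -/
lemma exists_countable_subset_iSup_le {U : Type*} {G : Set U} (hG : G.Nonempty) (f : U → EReal) :
    ∃ C ⊆ G, C.Countable ∧ C.Nonempty ∧ ⨆ u ∈ G, f u ≤ ⨆ u ∈ C, f u := by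
  obtain ⟨s, -, hs, hsG⟩ := exists_seq_tendsto_sSup (hG.image f) (OrderTop.bddAbove _)
  choose c hcG hc using hsG
  refine ⟨range c, range_subset_iff.2 hcG, countable_range c, range_nonempty c, ?_⟩
  rw [← sSup_image]
  refine le_of_tendsto' hs fun n => ?_
  rw [← hc n]
  exact le_iSup₂_of_le (c n) (mem_range_self n) le_rfl

/-- A countable set can be enlarged to a countable set that is closed under a set-valued map with
countable values. -/
lemma exists_countable_superset_forall_subset {α : Type*} {F : α → Set α}
    (hF : ∀ x, (F x).Countable) {D₀ : Set α} (hD₀ : D₀.Countable) :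
    ∃ D : Set α, D.Countable ∧ D₀ ⊆ D ∧ ∀ x ∈ D, F x ⊆ D := by
  let D : ℕ → Set α := fun n => (fun s => ⋃ x ∈ s, F x)^[n] D₀
  have hsucc : ∀ n, D (n + 1) = ⋃ x ∈ D n, F x := fun n =>
    Function.iterate_succ_apply' _ n D₀
  have hD : ∀ n, (D n).Countable := by
    intro n
    induction n with
    | zero => exact hD₀
    | succ n ih =>
      rw [hsucc]
      exact ih.biUnion fun x _ => hF x
  refine ⟨⋃ n, D n, countable_iUnion hD, subset_iUnion D 0, fun x hx => ?_⟩
  obtain ⟨n, hn⟩ := mem_iUnion.1 hx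
  refine Subset.trans ?_ (subset_iUnion D (n + 1))
  rw [hsucc]
  exact subset_biUnion_of_mem (u := F) hn

/-- If suprema over `G (x, q)` are attained along `A` for `x` in `D` and `q` in `Q`, then the same
holds for `x` in the closure of `D` and all parameters. -/
lemma iSup_le_iSup_inter_of_mem_closure {X P U : Type*} [TopologicalSpace X]
    [FrechetUrysohnSpace X] [TopologicalSpace P] {Q : Set P} {G : X × P → Set U}
    {φ : X × P → U → EReal} (hG_ne : ∀ z, (G z).Nonempty)
    (hG : ∀ (x : X) (p : P), ∀ u ∈ G (x, p), ∀ xn : ℕ → X,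
      Tendsto xn atTop (𝓝 x) →
        ∃ pn : ℕ → P, (∀ n, pn n ∈ Q) ∧ Tendsto pn atTop (𝓝 p) ∧
          ∀ᶠ n in atTop, u ∈ G (xn n, pn n) ∧ G (xn n, pn n) ⊆ G (x, p))
    (hφ : ∀ z : X × P, ∀ u ∈ G z, ∀ zn : ℕ → X × P,
      Tendsto zn atTop (𝓝 z) → Tendsto (fun n => φ (zn n) u) atTop (𝓝 (φ z u)))
    (hφ_sup : ∀ z : X × P, ∀ A : Set U, (A ∩ G z).Nonempty →
      ∀ zn : ℕ → X × P, Tendsto zn atTop (𝓝 z) →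
        limsup (fun n => ⨆ u ∈ A ∩ G z, φ (zn n) u) atTop ≤ ⨆ u ∈ A ∩ G z, φ z u)
    {A : Set U} {D : Set X}
    (hD : ∀ x ∈ D, ∀ q ∈ Q, (A ∩ G (x, q)).Nonempty ∧
      ⨆ u ∈ G (x, q), φ (x, q) u ≤ ⨆ u ∈ A ∩ G (x, q), φ (x, q) u)
    {x : X} (hx : x ∈ closure D) (p : P) :
    (A ∩ G (x, p)).Nonempty ∧
      ⨆ u ∈ G (x, p), φ (x, p) u ≤ ⨆ u ∈ A ∩ G (x, p), φ (x, p) u := by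
  obtain ⟨xn, hxnD, hxn⟩ := mem_closure_iff_seq_limit.1 hx
  have hne : (A ∩ G (x, p)).Nonempty := by
    obtain ⟨u, hu⟩ := hG_ne (x, p)
    obtain ⟨pn, hpnQ, -, hev⟩ := hG x p u hu xn hxn
    obtain ⟨n, -, hn⟩ := hev.exists
    exact (hD _ (hxnD n) _ (hpnQ n)).1.mono (inter_subset_inter_right A hn)
  refine ⟨hne, iSup₂_le fun u hu => ?_⟩
  obtain ⟨pn, hpnQ, hpn, hev⟩ := hG x p u hu xn hxn
  have hzn : Tendsto (fun n => (xn n, pn n)) atTop (𝓝 (x, p)) := hxn.prodMk_nhds hpn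
  calc
    φ (x, p) u = limsup (fun n => φ (xn n, pn n) u) atTop := (hφ _ u hu _ hzn).limsup_eq.symm
    _ ≤ limsup (fun n => ⨆ v ∈ A ∩ G (x, p), φ (xn n, pn n) v) atTop := by
      refine limsup_le_limsup ?_
      filter_upwards [hev] with n hn
      calc
        φ (xn n, pn n) u ≤ ⨆ v ∈ G (xn n, pn n), φ (xn n, pn n) v :=
          le_iSup₂_of_le u hn.1 le_rfl
        _ ≤ ⨆ v ∈ A ∩ G (xn n, pn n), φ (xn n, pn n) v := (hD _ (hxnD n) _ (hpnQ n)).2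
        _ ≤ ⨆ v ∈ A ∩ G (x, p), φ (xn n, pn n) v :=
          biSup_mono fun v hv => ⟨hv.1, hn.2 hv.2⟩
    _ ≤ ⨆ v ∈ A ∩ G (x, p), φ (x, p) v := hφ_sup _ A hne _ hzn

/-- Equality of suprema over `G` and over `A ∩ G` passes to limits in a variable in which the
family is continuous uniformly over `G`. -/
lemma iSup_le_iSup_inter_of_uniform {Y U : Type*} [PseudoMetricSpace Y] {G A : Set U}
    {φ : U → Y → EReal} {y : Y}
    (hφ : ∀ ε : ℝ, 0 < ε → ∃ δ : ℝ, 0 < δ ∧ ∀ y' : Y, dist y' y < δ → ∀ u ∈ G,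
      φ u y' ≤ φ u y + (ε : EReal) ∧ φ u y ≤ φ u y' + (ε : EReal))
    {D : Set Y} (hD : ∀ y' ∈ D, ⨆ u ∈ G, φ u y' ≤ ⨆ u ∈ A ∩ G, φ u y') (hy : y ∈ closure D) :
    ⨆ u ∈ G, φ u y ≤ ⨆ u ∈ A ∩ G, φ u y := by
  refine EReal.le_of_forall_pos_le_add_coe fun ε hε => iSup₂_le fun u hu => ?_
  obtain ⟨δ, hδ, hyδ⟩ := hφ (ε / 2) (half_pos hε)
  obtain ⟨y', hy'D, hy'⟩ := Metric.mem_closure_iff.1 hy δ hδ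
  rw [dist_comm] at hy'
  have hA : ⨆ v ∈ A ∩ G, φ v y' ≤ (⨆ v ∈ A ∩ G, φ v y) + ((ε / 2 : ℝ) : EReal) :=
    iSup₂_le fun v hv => (hyδ y' hy' v hv.2).1.trans <| by
      gcongr
      exact le_iSup₂_of_le v hv le_rfl
  calc
    φ u y ≤ φ u y' + ((ε / 2 : ℝ) : EReal) := (hyδ y' hy' u hu).2
    _ ≤ (⨆ v ∈ A ∩ G, φ v y) + ((ε / 2 : ℝ) : EReal) + ((ε / 2 : ℝ) : EReal) := by
      gcongr
      exact (le_iSup₂_of_le u hu le_rfl).trans ((hD y' hy'D).trans hA)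
    _ = (⨆ v ∈ A ∩ G, φ v y) + (ε : EReal) := by
      rw [add_assoc, ← EReal.coe_add, add_halves]

/-- The product version of the general separable-reducibility theorem (Theorem 2.4).
Here `X = X₁ × X₂` carries the product metric, `X₁^l` is modelled as `Fin l → X₁`,
`Φ` takes values in `ℝ ∪ {+∞}` (i.e. `EReal` values never equal to `⊥`), and the
uniform continuity in `y` (uniform over `u ∈ G z`) is expressed in the extended reals. -/
theorem general_separable_reducibility_product
    {X₁ X₂ P : Type*} [MetricSpace X₁] [MetricSpace X₂] [MetricSpace P]
    (Q : Set P) (hQcount : Q.Countable) (hQdense : Dense Q)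
    (l : ℕ) (hl : 1 ≤ l)
    (G : X₁ × P → Set (Fin l → X₁))
    (Φ : X₁ × P → (Fin l → X₁) → X₂ → EReal)
    (hΦ_ne_bot : ∀ z u y, Φ z u y ≠ ⊥)
    (hG_ne : ∀ z : X₁ × P, (G z).Nonempty)
    -- (A1.1)
    (hA1 : ∀ (x : X₁) (p : P), ∀ u ∈ G (x, p), ∀ xn : ℕ → X₁,
      Tendsto xn atTop (𝓝 x) →
        ∃ pn : ℕ → P, (∀ n, pn n ∈ Q) ∧ Tendsto pn atTop (𝓝 p) ∧
          ∀ᶠ n in atTop, u ∈ G (xn n, pn n) ∧ G (xn n, pn n) ⊆ G (x, p))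
    -- (A2.1), for each fixed y
    (hA21 : ∀ y : X₂, ∀ z : X₁ × P, ∀ u ∈ G z, ∀ zn : ℕ → X₁ × P,
      Tendsto zn atTop (𝓝 z) →
        Tendsto (fun n => Φ (zn n) u y) atTop (𝓝 (Φ z u y)))
    -- (A2.2), for each fixed y
    (hA22 : ∀ y : X₂, ∀ z : X₁ × P, ∀ A : Set (Fin l → X₁), (A ∩ G z).Nonempty →
      ∀ zn : ℕ → X₁ × P, Tendsto zn atTop (𝓝 z) →
        limsup (fun n => ⨆ u ∈ A ∩ G z, Φ (zn n) u y) atTop ≤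
          ⨆ u ∈ A ∩ G z, Φ z u y)
    -- continuity of `y ↦ Φ z u y` at every `y`, uniformly in `u ∈ G z`
    (hUC : ∀ z : X₁ × P, ∀ y : X₂, ∀ ε : ℝ, 0 < ε → ∃ δ : ℝ, 0 < δ ∧
      ∀ y' : X₂, dist y' y < δ → ∀ u ∈ G z,
        Φ z u y' ≤ Φ z u y + (ε : EReal) ∧ Φ z u y ≤ Φ z u y' + (ε : EReal)) :
    IsRichFamily {Y : Set (X₁ × X₂) |
      ∃ Y₁ : Set X₁, ∃ Y₂ : Set X₂,
        IsClosed Y₁ ∧ TopologicalSpace.IsSeparable Y₁ ∧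
        IsClosed Y₂ ∧ TopologicalSpace.IsSeparable Y₂ ∧
        Y = Y₁ ×ˢ Y₂ ∧
        ∀ x ∈ Y₁, ∀ y ∈ Y₂, ∀ p : P,
          ({u : Fin l → X₁ | ∀ i, u i ∈ Y₁} ∩ G (x, p)).Nonempty ∧
          (⨆ u ∈ G (x, p), Φ (x, p) u y) =
            ⨆ u ∈ {u : Fin l → X₁ | ∀ i, u i ∈ Y₁} ∩ G (x, p), Φ (x, p) u y} := by
  have key : ∀ (D₁ : Set X₁) (D₂ : Set X₂), IsSeparable D₁ → IsSeparable D₂ →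
      (∀ x ∈ D₁, ∀ y ∈ D₂, ∀ q ∈ Q, ∃ A : Set (Fin l → X₁), (∀ u ∈ A, ∀ i, u i ∈ D₁) ∧
        (A ∩ G (x, q)).Nonempty ∧
        ⨆ u ∈ G (x, q), Φ (x, q) u y ≤ ⨆ u ∈ A ∩ G (x, q), Φ (x, q) u y) →
      ∃ Y₁ : Set X₁, ∃ Y₂ : Set X₂,
        IsClosed Y₁ ∧ IsSeparable Y₁ ∧ IsClosed Y₂ ∧ IsSeparable Y₂ ∧
        closure (D₁ ×ˢ D₂) = Y₁ ×ˢ Y₂ ∧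
        ∀ x ∈ Y₁, ∀ y ∈ Y₂, ∀ p : P,
          ({u : Fin l → X₁ | ∀ i, u i ∈ Y₁} ∩ G (x, p)).Nonempty ∧
          (⨆ u ∈ G (x, p), Φ (x, p) u y) =
            ⨆ u ∈ {u : Fin l → X₁ | ∀ i, u i ∈ Y₁} ∩ G (x, p), Φ (x, p) u y := by
    intro D₁ D₂ hD₁ hD₂ hD
    refine ⟨closure D₁, closure D₂, isClosed_closure, hD₁.closure, isClosed_closure,
      hD₂.closure, closure_prod_eq, fun x hx y hy p => ?_⟩
    have hx_all : ∀ y' ∈ D₂, _ := fun y' hy' =>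
      iSup_le_iSup_inter_of_mem_closure (A := {u : Fin l → X₁ | ∀ i, u i ∈ closure D₁})
        hG_ne hA1 (hA21 y') (hA22 y')
        (fun x' hx' q hq => by
          obtain ⟨A, hAD, hne, hle⟩ := hD x' hx' y' hy' q hq
          have hsub := inter_subset_inter_left (G (x', q)) (show A ⊆ {u | ∀ i, u i ∈ closure D₁}
            from fun u hu i => subset_closure (hAD u hu i))
          exact ⟨hne.mono hsub, hle.trans (biSup_mono hsub)⟩) hx p
    obtain ⟨y₀, hy₀⟩ := closure_nonempty_iff.1 ⟨y, hy⟩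
    refine ⟨(hx_all y₀ hy₀).1, le_antisymm ?_ (biSup_mono fun _ hu => hu.2)⟩
    exact iSup_le_iSup_inter_of_uniform (hUC (x, p) y) (fun y' hy' => (hx_all y' hy').2) hy
  refine ⟨?_, fun Y₀ hY₀ => ?_, fun Y hY hmono => ?_⟩
  · rintro _ ⟨Y₁, Y₂, hc₁, hs₁, hc₂, hs₂, rfl, -⟩
    exact ⟨hc₁.prod hc₂, hs₁.prod hs₂⟩
  · obtain ⟨D, hD, hYD⟩ := hY₀
    choose C hCG hC hC_ne hC_le using fun (z : X₁ × P) (y : X₂) =>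
      exists_countable_subset_iSup_le (hG_ne z) (fun u => Φ z u y)
    have hD₂ : (Prod.snd '' D).Countable := hD.image _
    obtain ⟨D₁, hD₁, hDD₁, hclosed⟩ := exists_countable_superset_forall_subset
      (F := fun x => ⋃ q ∈ Q, ⋃ y ∈ Prod.snd '' D, ⋃ u ∈ C (x, q) y, range u)
      (fun x => hQcount.biUnion fun q _ => hD₂.biUnion fun y _ =>
        (hC (x, q) y).biUnion fun u _ => countable_range u) (hD.image Prod.fst)
    refine ⟨closure (D₁ ×ˢ (Prod.snd '' D)), key D₁ _ hD₁.isSeparable hD₂.isSeparable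
      fun x hx y hy q hq => ⟨C (x, q) y, fun u hu i => hclosed x hx ?_, ?_, ?_⟩, ?_⟩
    · simp only [mem_iUnion]
      exact ⟨q, hq, y, hy, u, hu, i, rfl⟩
    · rw [inter_eq_left.2 (hCG (x, q) y)]
      exact hC_ne (x, q) y
    · rw [inter_eq_left.2 (hCG (x, q) y)]
      exact hC_le (x, q) y
    · exact hYD.trans (closure_mono (subset_fst_image_prod_snd_image.trans
        (prod_mono_left hDD₁)))
  · have hY_mono : Monotone Y := monotone_nat_of_le_succ hmono
    have hmem : ∀ {a b}, a ∈ ⋃ n, Y n → b ∈ ⋃ n, Y n → ∃ n, a ∈ Y n ∧ b ∈ Y n := by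
      intro a b ha hb
      obtain ⟨m, hm⟩ := mem_iUnion.1 ha
      obtain ⟨k, hk⟩ := mem_iUnion.1 hb
      exact ⟨max m k, hY_mono (le_max_left m k) hm, hY_mono (le_max_right m k) hk⟩
    have hsep : IsSeparable (⋃ n, Y n) := .iUnion fun n => by
      obtain ⟨Y₁, Y₂, -, hs₁, -, hs₂, hYn, -⟩ := hY n
      exact hYn ▸ hs₁.prod hs₂
    have hprod : ⋃ n, Y n = (Prod.fst '' ⋃ n, Y n) ×ˢ (Prod.snd '' ⋃ n, Y n) := by
      refine subset_fst_image_prod_snd_image.antisymm ?_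
      rintro ⟨_, _⟩ ⟨⟨a, ha, rfl⟩, ⟨b, hb, rfl⟩⟩
      obtain ⟨n, han, hbn⟩ := hmem ha hb
      obtain ⟨Y₁, Y₂, -, -, -, -, hYn, -⟩ := hY n
      rw [hYn] at han hbn
      exact mem_iUnion.2 ⟨n, hYn ▸ ⟨han.1, hbn.2⟩⟩
    rw [hprod]
    refine key _ _ (hsep.image continuous_fst) (hsep.image continuous_snd) ?_
    rintro _ ⟨a, ha, rfl⟩ _ ⟨b, hb, rfl⟩ q -
    obtain ⟨n, han, hbn⟩ := hmem ha hb
    obtain ⟨Y₁, Y₂, -, -, -, -, hYn, hYn_sup⟩ := hY n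
    have han' := hYn ▸ han
    have hbn' := hYn ▸ hbn
    obtain ⟨hne, heq⟩ := hYn_sup a.1 han'.1 b.2 hbn'.2 q
    exact ⟨{u | ∀ i, u i ∈ Y₁}, fun u hu i => ⟨(u i, b.2), mem_iUnion.2 ⟨n, hYn ▸ ⟨hu i, hbn'.2⟩⟩, rfl⟩, hne, heq.le⟩
end

section
/- Let (X,d) be a metric space and f : X → ℝ a function. Then there is a rich family 𝓡 of closed separable subsets of X such that for every Y ∈ 𝓡 and every x ∈ Y one has limsup_{y→x} f(y) = limsup_{Y∋y→x} f(y), where the left-hand limsup is over y in X tending to x and the right-hand limsup is over y in Y tending to x. -/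
open Filter TopologicalSpace Set Metric
open scoped Topology

/-- The suprema of `f` over balls of rational radius centred in `Y` are not changed by restricting
`f` to `Y`. -/
def ReflectsBallSup {X : Type*} [MetricSpace X] (f : X → ℝ) (Y : Set X) : Prop :=
  ∀ y ∈ Y, ∀ r q : ℚ, (∃ z, dist z y < r ∧ (q : ℝ) < f z) →
    ∃ z ∈ Y, dist z y < r ∧ (q : ℝ) < f z

theorem ReflectsBallSup.iUnion {X : Type*} [MetricSpace X] {f : X → ℝ} {ι : Sort*} {Y : ι → Set X}
    (h : ∀ i, ReflectsBallSup f (Y i)) : ReflectsBallSup f (⋃ i, Y i) := by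
  intro y hy r q hz
  obtain ⟨i, hi⟩ := mem_iUnion.1 hy
  obtain ⟨z, hzY, hz⟩ := h i y hi r q hz
  exact ⟨z, mem_iUnion.2 ⟨i, hzY⟩, hz⟩

theorem ReflectsBallSup.closure {X : Type*} [MetricSpace X] {f : X → ℝ} {Y : Set X}
    (h : ReflectsBallSup f Y) : ReflectsBallSup f (closure Y) := by
  rintro y hy r q ⟨z, hzr, hqz⟩
  obtain ⟨s, hzs, hsr⟩ := exists_rat_btwn hzr
  obtain ⟨y', hy', hd⟩ := Metric.mem_closure_iff.1 hy (min (s - dist z y) (r - s))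
    (lt_min (sub_pos.2 hzs) (sub_pos.2 hsr))
  obtain ⟨hd₁, hd₂⟩ := lt_min_iff.1 hd
  obtain ⟨z', hz'Y, hz's, hqz'⟩ := h y' hy' s q
    ⟨z, by linarith [dist_triangle z y y'], hqz⟩
  exact ⟨z', subset_closure hz'Y,
    by linarith [dist_triangle z' y' y, dist_comm y y'], hqz'⟩

theorem exists_countable_superset_reflectsBallSup {X : Type*} [MetricSpace X] (f : X → ℝ)
    {C : Set X} (hC : C.Countable) : ∃ D, D.Countable ∧ C ⊆ D ∧ ReflectsBallSup f D := by
  have key : ∀ (p : ℚ × ℚ) (y : X), ∃ w, (∃ z, dist z y < p.1 ∧ (p.2 : ℝ) < f z) →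
      dist w y < p.1 ∧ (p.2 : ℝ) < f w := by
    intro p y
    by_cases h : ∃ z, dist z y < p.1 ∧ (p.2 : ℝ) < f z
    · exact h.imp fun _ hw _ => hw
    · exact ⟨y, fun h' => absurd h' h⟩
  choose g hg using key
  refine ⟨⋃ l : List (ℚ × ℚ), (fun c => l.foldr g c) '' C,
    countable_iUnion fun l => hC.image _, fun c hc => mem_iUnion.2 ⟨[], c, hc, rfl⟩, ?_⟩
  intro y hy r q hz
  obtain ⟨l, c, hc, rfl⟩ := mem_iUnion.1 hy
  exact ⟨_, mem_iUnion.2 ⟨(r, q) :: l, c, hc, rfl⟩, hg (r, q) _ hz⟩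

theorem ReflectsBallSup.limsup_nhds_eq {X : Type*} [MetricSpace X] {f : X → ℝ} {Y : Set X}
    (h : ReflectsBallSup f Y) {x : X} (hx : x ∈ Y) :
    limsup (fun y => (f y : EReal)) (𝓝 x) = limsup (fun y => (f y : EReal)) (𝓝[Y] x) := by
  refine le_antisymm (le_of_not_gt fun hlt => ?_) (limsup_le_limsup_of_le nhdsWithin_le_nhds)
  obtain ⟨q, hq₁, hq₂⟩ := EReal.lt_iff_exists_rat_btwn.1 hlt
  obtain ⟨ε, hε, hball⟩ := Metric.mem_nhdsWithin_iff.1 (eventually_lt_of_limsup_lt hq₁)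
  obtain ⟨r, hr, hrε⟩ := exists_rat_btwn hε
  obtain ⟨z, hqz, hzr⟩ :=
    ((frequently_lt_of_lt_limsup (by isBoundedDefault) hq₂).and_eventually
      (Metric.ball_mem_nhds x hr)).exists
  obtain ⟨w, hwY, hwr, hqw⟩ := h x hx r q ⟨z, hzr, EReal.coe_lt_coe_iff.1 hqz⟩
  have hwq : (f w : EReal) < ((q : ℝ) : EReal) := hball ⟨hwr.trans hrε, hwY⟩
  exact lt_asymm hqw (EReal.coe_lt_coe_iff.1 hwq)

/-- Separable reducibility of upper limits: there is a rich family `R` of closed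
separable subsets of `X` such that for every `Y ∈ R` and every `x ∈ Y`,
`limsup_{y→x} f(y) = limsup_{Y∋y→x} f(y)` (upper limits computed in the extended
reals, over neighborhoods of `x` in `X`, resp. relative neighborhoods in `Y`). -/
theorem separable_reduction_limsup {X : Type*} [MetricSpace X] (f : X → ℝ) :
    ∃ R : Set (Set X), IsRichFamily R ∧
      ∀ Y ∈ R, ∀ x ∈ Y,
        limsup (fun y => (f y : EReal)) (𝓝 x) =
          limsup (fun y => (f y : EReal)) (𝓝[Y] x) := by
  refine ⟨{Y | IsClosed Y ∧ IsSeparable Y ∧ ReflectsBallSup f Y},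
    ⟨fun Y hY => ⟨hY.1, hY.2.1⟩, fun Y₀ ⟨C, hC, hY₀⟩ => ?_, fun Y hY _ => ?_⟩,
    fun Y hY x hx => hY.2.2.limsup_nhds_eq hx⟩
  · obtain ⟨D, hD, hCD, hfD⟩ := exists_countable_superset_reflectsBallSup f hC
    exact ⟨closure D, ⟨isClosed_closure, hD.isSeparable.closure, hfD.closure⟩,
      hY₀.trans (closure_mono hCD)⟩
  · exact ⟨isClosed_closure, (IsSeparable.iUnion fun n => (hY n).2.1).closure,
      (ReflectsBallSup.iUnion fun n => (hY n).2.2).closure⟩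
end

section
/- Let (X,d) be a metric space and f : X → ℝ a function. Then there is a rich family 𝓡 of closed separable subsets of X such that for every Y ∈ 𝓡 and every x ∈ Y the Lipschitz modulus of f at x in X equals the Lipschitz modulus of the restriction f|_Y at x in the metric space Y: Lip f(x) = Lip (f|_Y)(x). -/
open Filter TopologicalSpace Set Metric
open scoped Topology

/-- The Lipschitz modulus of `f` at `x`:
`Lip f(x) = inf {c > 0 : ∃ r > 0, |f u₁ − f u₂| ≤ c·d(u₁,u₂) for all u₁,u₂ ∈ B(x,r)}`,
computed in the extended reals (so that `inf ∅ = +∞`). -/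
noncomputable def lipschitzModulus {X : Type*} [MetricSpace X] (f : X → ℝ) (x : X) :
    EReal :=
  sInf {c : EReal | ∃ c' : ℝ, c = (c' : EReal) ∧ 0 < c' ∧ ∃ r : ℝ, 0 < r ∧
    ∀ u₁ ∈ ball x r, ∀ u₂ ∈ ball x r, |f u₁ - f u₂| ≤ c' * dist u₁ u₂}

/-- The set `S` contains two points of `ball x r` between which `f` varies by more than
`c` times their distance. -/
def HasSteepPair {X : Type*} [MetricSpace X] (f : X → ℝ) (S : Set X) (x : X) (r c : ℝ) :
    Prop :=
  ∃ u₁ ∈ S, ∃ u₂ ∈ S, u₁ ∈ ball x r ∧ u₂ ∈ ball x r ∧ c * dist u₁ u₂ < |f u₁ - f u₂|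

theorem HasSteepPair.mono {X : Type*} [MetricSpace X] {f : X → ℝ} {S T : Set X} {x : X}
    {r c : ℝ} (h : HasSteepPair f S x r c) (hST : S ⊆ T) : HasSteepPair f T x r c := by
  obtain ⟨u₁, h₁, u₂, h₂, h⟩ := h
  exact ⟨u₁, hST h₁, u₂, hST h₂, h⟩

/-- If a set reflects steep pairs around its points for rational radii and slopes, then its
closure reflects them for all real radii and slopes. -/
theorem hasSteepPair_closure {X : Type*} [MetricSpace X] {f : X → ℝ} {D : Set X}
    (hD : ∀ y ∈ D, ∀ r c : ℚ, HasSteepPair f univ y r c → HasSteepPair f D y r c)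
    {x : X} (hx : x ∈ closure D) {r c : ℝ} (h : HasSteepPair f univ x r c) :
    HasSteepPair f (closure D) x r c := by
  obtain ⟨u₁, -, u₂, -, h₁, h₂, h⟩ := h
  rw [mem_ball] at h₁ h₂
  have hpos : 0 < dist u₁ u₂ := by
    refine dist_pos.2 ?_
    rintro rfl
    simp at h
  obtain ⟨q, hcq, hq⟩ := exists_rat_btwn ((lt_div_iff₀ hpos).2 h)
  rw [lt_div_iff₀ hpos] at hq
  set m := max (dist u₁ x) (dist u₂ x) with hm
  have hmr : m < r := max_lt h₁ h₂
  have hm₁ : dist u₁ x ≤ m := le_max_left _ _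
  have hm₂ : dist u₂ x ≤ m := le_max_right _ _
  obtain ⟨y, hyD, hy⟩ := Metric.mem_closure_iff.1 hx ((r - m) / 2) (by linarith)
  obtain ⟨s, hms, hsr⟩ := exists_rat_btwn (show m + dist x y < r - dist x y by linarith)
  have t₁ := dist_triangle u₁ x y
  have t₂ := dist_triangle u₂ x y
  obtain ⟨v₁, hv₁, v₂, hv₂, hb₁, hb₂, hv⟩ := hD y hyD s q
    ⟨u₁, mem_univ _, u₂, mem_univ _, mem_ball.2 (by linarith), mem_ball.2 (by linarith), hq⟩
  have hsub : ball y (s : ℝ) ⊆ ball x r :=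
    ball_subset_ball' (by rw [dist_comm y x]; linarith)
  exact ⟨v₁, subset_closure hv₁, v₂, subset_closure hv₂, hsub hb₁, hsub hb₂,
    (mul_le_mul_of_nonneg_right hcq.le dist_nonneg).trans_lt hv⟩

/-- Every countable set is contained in a countable set that reflects steep pairs around its
points for rational radii and slopes. -/
theorem exists_countable_superset_hasSteepPair {X : Type*} [MetricSpace X] (f : X → ℝ)
    {C : Set X} (hC : C.Countable) :
    ∃ D : Set X, C ⊆ D ∧ D.Countable ∧
      ∀ y ∈ D, ∀ r c : ℚ, HasSteepPair f univ y r c → HasSteepPair f D y r c := by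
  have key : ∀ (y : X) (p : ℚ × ℚ), ∃ S : Set X, S.Countable ∧
      (HasSteepPair f univ y p.1 p.2 → HasSteepPair f S y p.1 p.2) := by
    intro y p
    by_cases h : HasSteepPair f univ y p.1 p.2
    · obtain ⟨u₁, -, u₂, -, h⟩ := h
      exact ⟨{u₁, u₂}, (Set.toFinite _).countable,
        fun _ => ⟨u₁, by simp, u₂, by simp, h⟩⟩
    · exact ⟨∅, countable_empty, fun h' => absurd h' h⟩
  choose S hS hSf using key
  let step : Set X → Set X := fun A => ⋃ y ∈ A, ⋃ p, S y p
  refine ⟨⋃ n : ℕ, step^[n] C, subset_iUnion (fun n : ℕ => step^[n] C) 0,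
    countable_iUnion fun n => ?_, ?_⟩
  · induction n with
    | zero => exact hC
    | succ n ih =>
      rw [Function.iterate_succ_apply']
      exact ih.biUnion fun y _ => countable_iUnion fun p => hS y p
  · intro y hy r c h
    obtain ⟨n, hn⟩ := mem_iUnion.1 hy
    refine (hSf y (r, c) h).mono fun z hz => mem_iUnion.2 ⟨n + 1, ?_⟩
    rw [Function.iterate_succ_apply']
    exact mem_biUnion hn (mem_iUnion.2 ⟨(r, c), hz⟩)

/-- If `Y` reflects steep pairs around `x ∈ Y`, then restricting `f` to `Y` does not change
its Lipschitz modulus at `x`. -/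
theorem lipschitzModulus_eq_restrict {X : Type*} [MetricSpace X] (f : X → ℝ) {Y : Set X}
    {x : X} (hx : x ∈ Y)
    (h : ∀ r c : ℝ, HasSteepPair f univ x r c → HasSteepPair f Y x r c) :
    lipschitzModulus f x = lipschitzModulus (fun y : Y => f y) ⟨x, hx⟩ := by
  unfold lipschitzModulus
  congr 1
  ext a
  refine exists_congr fun c => and_congr_right fun _ => and_congr_right fun _ =>
    exists_congr fun r => and_congr_right fun _ => ⟨?_, ?_⟩
  · exact fun H u₁ h₁ u₂ h₂ => H u₁ h₁ u₂ h₂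
  · intro H u₁ h₁ u₂ h₂
    by_contra hlt
    obtain ⟨v₁, hv₁, v₂, hv₂, hb₁, hb₂, hv⟩ :=
      h r c ⟨u₁, mem_univ _, u₂, mem_univ _, h₁, h₂, not_le.1 hlt⟩
    exact hv.not_ge (H ⟨v₁, hv₁⟩ hb₁ ⟨v₂, hv₂⟩ hb₂)

/-- Separable reducibility of the local Lipschitz property (Theorem 3.3): there is a
rich family `R` of closed separable subsets of `X` such that for every `Y ∈ R` and
every `x ∈ Y`, the Lipschitz modulus of `f` at `x` in `X` equals the Lipschitz modulus
of the restriction of `f` to `Y` at `x`, computed in the metric space `Y`. -/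
theorem separable_reduction_lipschitz_modulus
    {X : Type*} [MetricSpace X] (f : X → ℝ) :
    ∃ R : Set (Set X), IsRichFamily R ∧
      ∀ Y ∈ R, ∀ x : X, ∀ hx : x ∈ Y,
        lipschitzModulus f x = lipschitzModulus (fun y : Y => f y) ⟨x, hx⟩ := by
  refine ⟨{Y | IsClosed Y ∧ IsSeparable Y ∧ ∀ x ∈ Y, ∀ r c : ℝ,
    HasSteepPair f univ x r c → HasSteepPair f Y x r c}, ⟨?_, ?_, ?_⟩, ?_⟩
  · exact fun Y hY => ⟨hY.1, hY.2.1⟩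
  · intro Y₀ hY₀
    obtain ⟨C, hC, hYC⟩ := hY₀
    obtain ⟨D, hCD, hD, h⟩ := exists_countable_superset_hasSteepPair f hC
    exact ⟨closure D, ⟨isClosed_closure, hD.isSeparable.closure,
      fun x hx r c => hasSteepPair_closure h hx⟩, hYC.trans (closure_mono hCD)⟩
  · intro Y hY _
    refine ⟨isClosed_closure, (IsSeparable.iUnion fun n => (hY n).2.1).closure,
      fun x hx r c => hasSteepPair_closure (fun y hy r c h => ?_) hx⟩
    obtain ⟨n, hn⟩ := mem_iUnion.1 hy
    exact ((hY n).2.2 y hn r c h).mono (subset_iUnion Y n)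
  · intro Y hY x hx
    exact lipschitzModulus_eq_restrict f hx (hY.2.2 x hx)
end

section
/- Let (X,d) be a metric space and f : X → ℝ ∪ {+∞} a proper extended real-valued function. Then there is a rich family 𝓡 of closed separable subsets of X such that for every Y ∈ 𝓡 and every x ∈ Y the slope of f at x computed in X equals the slope of the restriction f|_Y at x computed in the metric space Y: |∇f|(x) = |∇(f|_Y)|(x). -/
open Filter TopologicalSpace Set Metric
open scoped Topology

/-- The slope `|∇f|(x) = limsup_{u→x, u≠x} (f x − f u)⁺ / d(x,u)` of an extended
real-valued function, computed in the extended reals. Note that in `EReal` one has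
`⊤ - ⊤ = ⊥`, so `max (⊤ - ⊤) 0 = 0`, realizing the convention `(+∞) − (+∞) = 0`. -/
noncomputable def eslope {X : Type*} [MetricSpace X] (f : X → EReal) (x : X) : EReal :=
  limsup (fun u => max (f x - f u) 0 / (dist x u : EReal)) (𝓝[≠] x)

/-- On every ball centred at a point of `D`, the infimum of `f` can be computed along `D`, and
the centre is the only point of `D` in the ball only if it is the only point of the ball. -/
def IsBallReducing {X : Type*} [MetricSpace X] (f : X → EReal) (D : Set X) : Prop :=
  ∀ y ∈ D, ∀ s : ℝ, ∀ u, dist u y < s →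
    (∀ q, f u < q → ∃ v ∈ D, dist v y < s ∧ f v < q) ∧
    (u ≠ y → ∃ v ∈ D, dist v y < s ∧ v ≠ y)

theorem IsBallReducing.closure {X : Type*} [MetricSpace X] {f : X → EReal} {D : Set X}
    (hD : IsBallReducing f D) : IsBallReducing f (closure D) := by
  intro y hy s u hu
  refine ⟨fun q hq => ?_, fun huy => ?_⟩
  · obtain ⟨z, hz, hyz⟩ := Metric.mem_closure_iff.1 hy ((s - dist u y) / 2) (by linarith)
    have h1 := dist_triangle u y z
    obtain ⟨v, hv, hvz, hvq⟩ := (hD z hz (s - dist y z) u (by linarith)).1 q hq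
    have h2 := dist_triangle v z y
    rw [dist_comm z y] at h2
    exact ⟨v, subset_closure hv, by linarith, hvq⟩
  · by_cases hyD : y ∈ D
    · obtain ⟨v, hv, h⟩ := (hD y hyD s u hu).2 huy
      exact ⟨v, subset_closure hv, h⟩
    · obtain ⟨z, hz, hyz⟩ := Metric.mem_closure_iff.1 hy s (dist_nonneg.trans_lt hu)
      exact ⟨z, subset_closure hz, by rwa [dist_comm], fun h => hyD (h ▸ hz)⟩

theorem IsBallReducing.iUnion {X ι : Type*} [MetricSpace X] {f : X → EReal} {D : ι → Set X}
    (hD : ∀ i, IsBallReducing f (D i)) : IsBallReducing f (⋃ i, D i) := by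
  intro y hy s u hu
  obtain ⟨i, hi⟩ := mem_iUnion.1 hy
  obtain ⟨h1, h2⟩ := hD i y hi s u hu
  refine ⟨fun q hq => ?_, fun huy => ?_⟩
  · obtain ⟨v, hv, h⟩ := h1 q hq
    exact ⟨v, mem_iUnion_of_mem i hv, h⟩
  · obtain ⟨v, hv, h⟩ := h2 huy
    exact ⟨v, mem_iUnion_of_mem i hv, h⟩

theorem exists_countable_ball_witnesses {X : Type*} [MetricSpace X] (f : X → EReal) (y : X) :
    ∃ C : Set X, C.Countable ∧ ∀ s : ℝ, ∀ u, dist u y < s →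
      (∀ q, f u < q → ∃ v ∈ C, dist v y < s ∧ f v < q) ∧
      (u ≠ y → ∃ v ∈ C, dist v y < s ∧ v ≠ y) := by
  have hg : ∀ p : ℚ × ℚ, ∃ v, (∃ u, dist u y < (p.1 : ℝ) ∧ f u < ((p.2 : ℝ) : EReal)) →
      dist v y < (p.1 : ℝ) ∧ f v < ((p.2 : ℝ) : EReal) := fun p => by
    by_cases h : ∃ u, dist u y < (p.1 : ℝ) ∧ f u < ((p.2 : ℝ) : EReal)
    · exact h.imp fun v hv _ => hv
    · exact ⟨y, fun hn => absurd hn h⟩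
  have hk : ∀ p : ℚ, ∃ v, (∃ u, dist u y < (p : ℝ) ∧ u ≠ y) → dist v y < (p : ℝ) ∧ v ≠ y :=
    fun p => by
      by_cases h : ∃ u, dist u y < (p : ℝ) ∧ u ≠ y
      · exact h.imp fun v hv _ => hv
      · exact ⟨y, fun hn => absurd hn h⟩
  choose g hg using hg
  choose k hk using hk
  refine ⟨range g ∪ range k, (countable_range g).union (countable_range k), fun s u hu => ?_⟩
  obtain ⟨r, hur, hrs⟩ := exists_rat_btwn hu
  refine ⟨fun q hq => ?_, fun huy => ?_⟩
  · obtain ⟨t, hut, htq⟩ := EReal.lt_iff_exists_rat_btwn.1 hq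
    obtain ⟨h1, h2⟩ := hg (r, t) ⟨u, hur, hut⟩
    exact ⟨g (r, t), .inl ⟨_, rfl⟩, h1.trans hrs, h2.trans htq⟩
  · obtain ⟨h1, h2⟩ := hk r ⟨u, hur, huy⟩
    exact ⟨k r, .inr ⟨_, rfl⟩, h1.trans hrs, h2⟩

theorem exists_countable_isBallReducing {X : Type*} [MetricSpace X] (f : X → EReal)
    {D₀ : Set X} (hD₀ : D₀.Countable) :
    ∃ D, D₀ ⊆ D ∧ D.Countable ∧ IsBallReducing f D := by
  choose C hC hCw using exists_countable_ball_witnesses f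
  let E : ℕ → Set X := fun n => Nat.rec D₀ (fun _ A => ⋃ y ∈ A, C y) n
  have hE : ∀ n, (E n).Countable := fun n => by
    induction n with
    | zero => exact hD₀
    | succ n ih => exact ih.biUnion fun y _ => hC y
  refine ⟨⋃ n, E n, subset_iUnion E 0, countable_iUnion hE, fun y hy s u hu => ?_⟩
  obtain ⟨n, hn⟩ := mem_iUnion.1 hy
  have hsub : C y ⊆ ⋃ n, E n :=
    (subset_biUnion_of_mem (u := C) hn).trans (subset_iUnion E (n + 1))
  obtain ⟨h1, h2⟩ := hCw y s u hu
  refine ⟨fun q hq => ?_, fun huy => ?_⟩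
  · obtain ⟨v, hv, h⟩ := h1 q hq
    exact ⟨v, hsub hv, h⟩
  · obtain ⟨v, hv, h⟩ := h2 huy
    exact ⟨v, hsub hv, h⟩

theorem isRichFamily_isBallReducing {X : Type*} [MetricSpace X] (f : X → EReal) :
    IsRichFamily {Y : Set X | IsClosed Y ∧ IsSeparable Y ∧ IsBallReducing f Y} := by
  refine ⟨fun Y hY => ⟨hY.1, hY.2.1⟩, fun Y₀ ⟨D₀, hD₀, hsub⟩ => ?_, fun Y hY _ => ?_⟩
  · obtain ⟨D, hDD, hDc, hD⟩ := exists_countable_isBallReducing f hD₀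
    exact ⟨closure D, ⟨isClosed_closure, hDc.isSeparable.closure, hD.closure⟩,
      hsub.trans (closure_mono hDD)⟩
  · exact ⟨isClosed_closure, (IsSeparable.iUnion fun n => (hY n).2.1).closure,
      (IsBallReducing.iUnion fun n => (hY n).2.2).closure⟩

theorem eslope_restrict_le {X : Type*} [MetricSpace X] (f : X → EReal) {Y : Set X} {x : X}
    (hx : x ∈ Y) : eslope (fun y : Y => f y) ⟨x, hx⟩ ≤ eslope f x := by
  have ht : Tendsto (Subtype.val : Y → X) (𝓝[≠] ⟨x, hx⟩) (𝓝[≠] x) :=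
    tendsto_nhdsWithin_of_tendsto_nhds_of_eventually_within _
      (continuous_subtype_val.continuousAt.tendsto.mono_left nhdsWithin_le_nhds)
      (eventually_mem_nhdsWithin.mono fun y hy h => hy (Subtype.ext h))
  unfold eslope
  exact limsup_le_limsup_of_le (u := fun u => max (f x - f u) 0 / (dist x u : EReal)) ht

/-- A difference quotient exceeding `c` at a point `u` is matched in any ball-reducing set
containing the base point, at no substantially larger distance. -/
theorem IsBallReducing.exists_le_quotient {X : Type*} [MetricSpace X] {f : X → EReal}
    (hf : ∀ x, f x ≠ ⊥) {Y : Set X} (hY : IsBallReducing f Y) {x : X} (hx : x ∈ Y)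
    {c : ℝ} (hc : 0 ≤ c) {ε : ℝ} {u : X} (hux : u ≠ x) (hu : dist u x < ε)
    (hcu : (c : EReal) < max (f x - f u) 0 / (dist x u : EReal)) :
    ∃ v ∈ Y, v ≠ x ∧ dist v x < ε ∧
      (c : EReal) ≤ max (f x - f v) 0 / (dist x v : EReal) := by
  have hd : 0 < dist x u := dist_pos.2 hux.symm
  rw [EReal.lt_div_iff (by exact_mod_cast hd) (EReal.coe_ne_top _), ← EReal.coe_mul,
    lt_max_iff] at hcu
  have hlt : ((c * dist x u : ℝ) : EReal) < f x - f u := by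
    refine hcu.resolve_right (not_lt.2 ?_)
    exact_mod_cast mul_nonneg hc hd.le
  have htop : f u ≠ ⊤ := fun h => by
    rw [h, EReal.sub_top] at hlt
    exact not_lt_bot hlt
  obtain ⟨b, hb⟩ : ∃ b : ℝ, f u = b := ⟨_, (EReal.coe_toReal htop (hf u)).symm⟩
  have hlt' : ((c * dist x u + b : ℝ) : EReal) < f x := by
    rw [hb] at hlt
    rw [EReal.coe_add]
    exact EReal.add_lt_of_lt_sub hlt
  obtain ⟨a, hba, hax⟩ := EReal.lt_iff_exists_real_btwn.1 hlt'
  have hba : c * dist x u + b < a := by exact_mod_cast hba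
  obtain ⟨s, hds, hsε, hsa⟩ : ∃ s, dist x u < s ∧ s < ε ∧ c * s + b < a := by
    have h1 : ∀ᶠ s in 𝓝[>] dist x u, c * s + b < a :=
      nhdsWithin_le_nhds ((by fun_prop : Continuous fun s : ℝ => c * s + b).continuousAt.eventually
        (gt_mem_nhds hba))
    have h2 : ∀ᶠ s in 𝓝[>] dist x u, s < ε :=
      nhdsWithin_le_nhds (gt_mem_nhds (by rwa [dist_comm]))
    obtain ⟨s, hs1, hs2, hs3⟩ := (eventually_mem_nhdsWithin.and (h2.and h1)).exists
    exact ⟨s, hs1, hs2, hs3⟩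
  obtain ⟨v, hv, hvs, hvq⟩ := (hY x hx s u (by rwa [dist_comm])).1 ((a - c * s : ℝ) : EReal)
    (by rw [hb]; exact_mod_cast (by linarith : b < a - c * s))
  obtain ⟨b', hb'⟩ : ∃ b' : ℝ, f v = b' :=
    ⟨_, (EReal.coe_toReal hvq.ne_top (hf v)).symm⟩
  rw [hb'] at hvq
  have hvq : b' < a - c * s := by exact_mod_cast hvq
  have hcs : 0 ≤ c * s := mul_nonneg hc (hd.trans hds).le
  have hvx : v ≠ x := fun h => by
    rw [← h, hb'] at hax
    have : a < b' := by exact_mod_cast hax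
    linarith
  refine ⟨v, hv, hvx, hvs.trans hsε, ?_⟩
  have hd' : 0 < dist x v := dist_pos.2 hvx.symm
  rw [EReal.le_div_iff_mul_le (by exact_mod_cast hd') (EReal.coe_ne_top _), ← EReal.coe_mul]
  refine le_max_of_le_left ?_
  have h3 : c * dist x v ≤ c * s :=
    mul_le_mul_of_nonneg_left (by rw [dist_comm]; exact hvs.le) hc
  calc ((c * dist x v : ℝ) : EReal) ≤ ((a - b' : ℝ) : EReal) := by
        exact_mod_cast (by linarith : c * dist x v ≤ a - b')
    _ = (a : EReal) - b' := EReal.coe_sub _ _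
    _ ≤ f x - f v := by rw [hb']; exact EReal.sub_le_sub hax.le le_rfl

theorem IsBallReducing.eslope_le {X : Type*} [MetricSpace X] {f : X → EReal}
    (hf : ∀ x, f x ≠ ⊥) {Y : Set X} (hY : IsBallReducing f Y) {x : X} (hx : x ∈ Y) :
    eslope f x ≤ eslope (fun y : Y => f y) ⟨x, hx⟩ := by
  refine le_of_forall_lt fun c' hc' => ?_
  obtain ⟨c, hcc', hc⟩ := EReal.lt_iff_exists_real_btwn.1 hc'
  refine hcc'.trans_le ?_
  have hfreq := frequently_lt_of_lt_limsup (by isBoundedDefault) hc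
  refine le_limsup_of_frequently_le ?_ (by isBoundedDefault)
  refine (nhdsWithin_hasBasis Metric.nhds_basis_ball _).frequently_iff.2 fun ε hε => ?_
  obtain ⟨u, ⟨huε, hux⟩, hcu⟩ :=
    (nhdsWithin_hasBasis Metric.nhds_basis_ball _).frequently_iff.1 hfreq ε hε
  obtain hc0 | hc0 := le_total 0 c
  · obtain ⟨v, hv, hvx, hvε, hcv⟩ := hY.exists_le_quotient hf hx hc0 hux huε hcu
    exact ⟨⟨v, hv⟩, ⟨hvε, fun h => hvx (congrArg Subtype.val h)⟩, hcv⟩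
  · obtain ⟨v, hv, hvε, hvx⟩ := (hY x hx ε u huε).2 hux
    refine ⟨⟨v, hv⟩, ⟨hvε, fun h => hvx (congrArg Subtype.val h)⟩, ?_⟩
    exact (by exact_mod_cast hc0 : (c : EReal) ≤ 0).trans
      (EReal.div_nonneg (le_max_right _ _) (by exact_mod_cast dist_nonneg))

/-- Theorem 4.2 (separable determinacy of slopes): for a proper function
`f : X → ℝ ∪ {+∞}` (modelled as an `EReal`-valued function never equal to `⊥` and
not identically `⊤`) there is a rich family `R` of closed separable subsets of `X`
such that for every `Y ∈ R` and every `x ∈ Y`, the slope of `f` at `x` computed in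
`X` equals the slope of the restriction of `f` to `Y` at `x`, computed in the metric
space `Y`. -/
theorem separable_reduction_slope
    {X : Type*} [MetricSpace X] (f : X → EReal)
    (hf_ne_bot : ∀ x, f x ≠ ⊥) (hf_proper : ∃ x, f x ≠ ⊤) :
    ∃ R : Set (Set X), IsRichFamily R ∧
      ∀ Y ∈ R, ∀ x : X, ∀ hx : x ∈ Y,
        eslope f x = eslope (fun y : Y => f y) ⟨x, hx⟩ :=
  ⟨_, isRichFamily_isBallReducing f, fun _ hY _ hx =>
    (hY.2.2.eslope_le hf_ne_bot hx).antisymm (eslope_restrict_le f hx)⟩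
end
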